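/- Let G be a k-regular graph. Then the vertex set of G can be equitably partitioned into (1 - o_k(1))·k/ln k parts, each of which is a total dominating set of G. -/

import Mathlib

open Finset Real

/-- The points of a finite space that lie in none of the events `A i` with `i ∈ S`. -/
def avoiding {Ω ι : Type*} [Fintype Ω] [DecidableEq Ω] (A : ι → Finset Ω) (S : Finset ι) :
    Finset Ω :=
  {x | ∀ i ∈ S, x ∉ A i}

section LocalLemma

variable {Ω ι : Type*} [Fintype Ω] [DecidableEq Ω]

theorem mem_avoiding {A : ι → Finset Ω} {S : Finset ι} {x : Ω} :
    x ∈ avoiding A S ↔ ∀ i ∈ S, x ∉ A i := by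
  simp [avoiding]

theorem avoiding_antitone {A : ι → Finset Ω} {S T : Finset ι} (h : S ⊆ T) :
    avoiding A T ⊆ avoiding A S := fun _ hx =>
  mem_avoiding.2 fun i hi => mem_avoiding.1 hx i (h hi)

variable [DecidableEq ι]

/-- The conditional probability estimate behind the symmetric Lovász local lemma. -/
theorem card_inter_avoiding_le (A : ι → Finset Ω) (Γ : ι → Finset ι) {p : ℝ} {d : ℕ}
    (hp : 0 ≤ p) (hd : ∀ i, #(Γ i) ≤ d) (hpd : 4 * p * d ≤ 1)
    (hA : ∀ i, (#(A i) : ℝ) ≤ p * Fintype.card Ω)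
    (hind : ∀ i S, Disjoint S (Γ i) →
      #(A i ∩ avoiding A S) * Fintype.card Ω = #(A i) * #(avoiding A S))
    (S : Finset ι) (i : ι) :
    (#(A i ∩ avoiding A S) : ℝ) ≤ 2 * p * #(avoiding A S) := by
  induction S using Finset.strongInduction generalizing i with
  | H S ih =>
    have hfar : (#(A i ∩ avoiding A (S \ Γ i)) : ℝ) ≤ p * #(avoiding A (S \ Γ i)) := by
      rcases Nat.eq_zero_or_pos (Fintype.card Ω) with h0 | h0
      · have : IsEmpty Ω := Fintype.card_eq_zero_iff.1 h0
        simp [Finset.eq_empty_of_isEmpty]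
      · have h := hind i (S \ Γ i) sdiff_disjoint
        have h' : (#(A i ∩ avoiding A (S \ Γ i)) : ℝ) * Fintype.card Ω
            = #(A i) * #(avoiding A (S \ Γ i)) := by exact_mod_cast h
        have h0' : (0 : ℝ) < Fintype.card Ω := by exact_mod_cast h0
        refine le_of_mul_le_mul_right ?_ h0'
        rw [h']
        calc _ ≤ (p * Fintype.card Ω) * #(avoiding A (S \ Γ i)) := by gcongr; exact hA i
          _ = _ := by ring
    have hsub : (#(A i ∩ avoiding A S) : ℝ) ≤ #(A i ∩ avoiding A (S \ Γ i)) := by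
      exact_mod_cast card_le_card (inter_subset_inter_left (avoiding_antitone sdiff_subset))
    by_cases hS : S ∩ Γ i = ∅
    · have : S \ Γ i = S := sdiff_eq_self_of_disjoint (disjoint_iff_inter_eq_empty.2 hS)
      rw [this] at hfar
      have : (0 : ℝ) ≤ p * #(avoiding A S) := by positivity
      linarith
    · have hlt : S \ Γ i ⊂ S := by
        refine Finset.ssubset_iff_subset_ne.2 ⟨sdiff_subset, fun h => hS ?_⟩
        rw [← disjoint_iff_inter_eq_empty]
        exact sdiff_eq_self_iff_disjoint.1 h
      have hcover : avoiding A (S \ Γ i) ⊆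
          avoiding A S ∪ (S ∩ Γ i).biUnion fun j => A j ∩ avoiding A (S \ Γ i) := by
        intro x hx
        by_cases hxS : x ∈ avoiding A S
        · exact mem_union_left _ hxS
        · refine mem_union_right _ ?_
          rw [mem_avoiding] at hxS
          push Not at hxS
          obtain ⟨j, hj, hxj⟩ := hxS
          have hjΓ : j ∈ Γ i := by
            by_contra hjΓ
            exact mem_avoiding.1 hx j (mem_sdiff.2 ⟨hj, hjΓ⟩) hxj
          exact mem_biUnion.2 ⟨j, mem_inter.2 ⟨hj, hjΓ⟩, mem_inter.2 ⟨hxj, hx⟩⟩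
      have hcard : (#(avoiding A (S \ Γ i)) : ℝ) ≤
          #(avoiding A S) + ∑ j ∈ S ∩ Γ i, (#(A j ∩ avoiding A (S \ Γ i)) : ℝ) := by
        exact_mod_cast (card_le_card hcover).trans
          ((card_union_le _ _).trans (Nat.add_le_add_left card_biUnion_le _))
      have hsum : ∑ j ∈ S ∩ Γ i, (#(A j ∩ avoiding A (S \ Γ i)) : ℝ) ≤
          d * (2 * p * #(avoiding A (S \ Γ i))) := by
        refine (sum_le_card_nsmul _ _ _ fun j _ => ih _ hlt j).trans ?_
        rw [nsmul_eq_mul]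
        gcongr
        exact (card_le_card inter_subset_right).trans (hd i)
      have hhalf : (#(avoiding A (S \ Γ i)) : ℝ) ≤ 2 * #(avoiding A S) := by
        have := mul_le_mul_of_nonneg_right hpd (Nat.cast_nonneg (α := ℝ) #(avoiding A (S \ Γ i)))
        linarith
      have := mul_le_mul_of_nonneg_left hhalf hp
      linarith

/-- The symmetric Lovász local lemma on a finite uniform probability space. -/
theorem exists_forall_notMem_of_local_lemma [Nonempty Ω] [Fintype ι]
    (A : ι → Finset Ω) (Γ : ι → Finset ι)
    {p : ℝ} {d : ℕ} (hp : 0 ≤ p) (hd0 : 0 < d) (hd : ∀ i, #(Γ i) ≤ d) (hpd : 4 * p * d ≤ 1)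
    (hA : ∀ i, (#(A i) : ℝ) ≤ p * Fintype.card Ω)
    (hind : ∀ i S, Disjoint S (Γ i) →
      #(A i ∩ avoiding A S) * Fintype.card Ω = #(A i) * #(avoiding A S)) :
    ∃ x, ∀ i, x ∉ A i := by
  suffices h : ∀ S, (avoiding A S).Nonempty by
    obtain ⟨x, hx⟩ := h univ
    exact ⟨x, fun i => mem_avoiding.1 hx i (mem_univ i)⟩
  intro S
  induction S using Finset.induction_on with
  | empty => exact ⟨Classical.arbitrary Ω, by simp [mem_avoiding]⟩
  | insert i S _ ih =>
    by_contra hne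
    rw [not_nonempty_iff_eq_empty] at hne
    have hsub : avoiding A S ⊆ A i ∩ avoiding A S := by
      intro x hx
      refine mem_inter.2 ⟨?_, hx⟩
      by_contra hxi
      have : x ∈ avoiding A (insert i S) := by
        rw [mem_avoiding]
        intro j hj
        rcases mem_insert.1 hj with rfl | hj
        · exact hxi
        · exact mem_avoiding.1 hx j hj
      simp [hne] at this
    have h1 : (#(avoiding A S) : ℝ) ≤ #(A i ∩ avoiding A S) := by
      exact_mod_cast card_le_card hsub
    have h2 := card_inter_avoiding_le A Γ hp hd hpd hA hind S i
    have h3 : (0 : ℝ) < #(avoiding A S) := by exact_mod_cast card_pos.2 ih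
    have h4 : (1 : ℝ) ≤ d := by exact_mod_cast hd0
    nlinarith

end LocalLemma

/-- Events determined by disjoint sets of coordinates are independent. -/
theorem card_inter_mul_card_pi {β α : Type*} [Fintype β] [DecidableEq β] [Fintype α]
    [DecidableEq α] (T : Finset β) (A B : Finset (β → α))
    (hA : ∀ x y, (∀ q ∈ T, x q = y q) → x ∈ A → y ∈ A)
    (hB : ∀ x y, (∀ q ∉ T, x q = y q) → x ∈ B → y ∈ B) :
    #(A ∩ B) * Fintype.card (β → α) = #A * #B := by
  rw [← card_univ, ← card_product, ← card_product]
  let f : (β → α) × (β → α) → (β → α) × (β → α) := fun z =>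
    (T.piecewise z.1 z.2, T.piecewise z.2 z.1)
  have hf : ∀ z, f (f z) = z := by
    intro z
    ext q <;> by_cases hq : q ∈ T <;> simp [f, hq]
  refine card_nbij' f f ?_ ?_ (fun z _ => hf z) (fun z _ => hf z)
  · rintro ⟨x, y⟩ hz
    simp only [coe_product, Set.mem_prod, mem_coe, mem_inter, mem_univ, and_true] at hz ⊢
    exact ⟨hA x _ (fun q hq => by simp [f, hq]) hz.1, hB x _ (fun q hq => by simp [f, hq]) hz.2⟩
  · rintro ⟨x, y⟩ hz
    simp only [coe_product, Set.mem_prod, mem_coe, mem_inter, mem_univ, and_true] at hz ⊢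
    exact ⟨hA x _ (fun q hq => by simp [f, hq]) hz.1, hB y _ (fun q hq => by simp [f, hq]) hz.2⟩

/-- The Chernoff lower tail bound for the number of elements of `F` that receive colour `j` when each
block of vertices is coloured by an independent uniform cyclic shift. -/
theorem card_few_of_color_le {V β : Type*} [Fintype β] [DecidableEq β]
    {r : ℕ} [NeZero r] (F : Finset V) (blk : V → β) (pos : V → Fin r)
    (hinj : ∀ u ∈ F, ∀ v ∈ F, blk u = blk v → pos u = pos v → u = v)
    (j : Fin r) (a : ℝ) {l : ℝ} (hl : 0 ≤ l) :
    (#{x : β → Fin r | (#{v ∈ F | pos v + x (blk v) = j} : ℝ) ≤ a} : ℝ) ≤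
      exp (l * a - (1 - exp (-l)) * (#F / r)) * Fintype.card (β → Fin r) := by
  have hr : (0 : ℝ) < r := by exact_mod_cast Nat.pos_of_ne_zero (NeZero.ne r)
  let h : β → Fin r → ℕ := fun q y => #{v ∈ F | blk v = q ∧ pos v + y = j}
  have hX : ∀ x : β → Fin r, #{v ∈ F | pos v + x (blk v) = j} = ∑ q, h q (x q) := by
    intro x
    rw [card_eq_sum_card_fiberwise (f := blk) (t := univ) (fun _ _ => by simp)]
    refine sum_congr rfl fun q _ => ?_
    rw [filter_filter]
    refine congrArg card (filter_congr fun v _ => ⟨?_, ?_⟩)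
    · rintro ⟨h1, rfl⟩; exact ⟨rfl, h1⟩
    · rintro ⟨rfl, h1⟩; exact ⟨h1, rfl⟩
  have hone : ∀ q y, h q y = 0 ∨ h q y = 1 := by
    intro q y
    have : h q y ≤ 1 := by
      refine card_le_one.2 fun u hu v hv => ?_
      simp only [mem_filter] at hu hv
      exact hinj u hu.1 v hv.1 (hu.2.1.trans hv.2.1.symm)
        (add_right_cancel (hu.2.2.trans hv.2.2.symm))
    omega
  have hm : ∀ q, ∑ y, h q y = #{v ∈ F | blk v = q} := by
    intro q
    rw [card_eq_sum_card_fiberwise (f := fun v => j - pos v) (t := univ) (fun _ _ => by simp)]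
    refine sum_congr rfl fun y _ => ?_
    rw [filter_filter]
    refine congrArg card (filter_congr fun v _ => and_congr_right fun _ => ?_)
    rw [sub_eq_iff_eq_add, add_comm, eq_comm]
  have hfac : ∀ q, ∑ y, exp (-l * h q y) ≤
      r * exp (-((1 - exp (-l)) * (#{v ∈ F | blk v = q} / r))) := by
    intro q
    have h1 : ∀ y, exp (-l * h q y) = 1 - (1 - exp (-l)) * h q y := by
      intro y
      rcases hone q y with h0 | h0 <;> simp [h0]
    have h2 : ∑ y, exp (-l * h q y) = r - (1 - exp (-l)) * #{v ∈ F | blk v = q} := by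
      rw [sum_congr rfl fun y _ => h1 y, sum_sub_distrib, ← mul_sum, ← hm q]
      simp
    rw [h2]
    have h3 := add_one_le_exp (-((1 - exp (-l)) * (#{v ∈ F | blk v = q} / r)))
    calc _ = r * (-((1 - exp (-l)) * (#{v ∈ F | blk v = q} / r)) + 1) := by field_simp; ring
      _ ≤ _ := by gcongr
  have hmgf : ∑ x : β → Fin r, exp (-l * #{v ∈ F | pos v + x (blk v) = j}) ≤
      exp (-((1 - exp (-l)) * (#F / r))) * Fintype.card (β → Fin r) := by
    calc _ = ∑ x : β → Fin r, ∏ q, exp (-l * h q (x q)) := by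
          refine sum_congr rfl fun x _ => ?_
          rw [hX x, ← exp_sum, ← mul_sum]
          push_cast
          rfl
      _ = ∏ q, ∑ y, exp (-l * h q y) := by
          rw [prod_univ_sum, Fintype.piFinset_univ]
      _ ≤ ∏ q, (r * exp (-((1 - exp (-l)) * (#{v ∈ F | blk v = q} / r)))) :=
          prod_le_prod (fun q _ => by positivity) fun q _ => hfac q
      _ = _ := by
          rw [prod_mul_distrib, ← exp_sum, mul_comm]
          congr 1
          · congr 1
            rw [sum_neg_distrib, ← mul_sum, ← sum_div]
            congr 3
            rw [card_eq_sum_card_fiberwise (f := blk) (t := univ) (fun _ _ => by simp)]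
            push_cast
            rfl
          · simp
  calc (#{x : β → Fin r | (#{v ∈ F | pos v + x (blk v) = j} : ℝ) ≤ a} : ℝ)
      = ∑ x : β → Fin r with (#{v ∈ F | pos v + x (blk v) = j} : ℝ) ≤ a, (1 : ℝ) := by simp
    _ ≤ ∑ x : β → Fin r with (#{v ∈ F | pos v + x (blk v) = j} : ℝ) ≤ a,
        exp (l * a) * exp (-l * #{v ∈ F | pos v + x (blk v) = j}) := by
        refine sum_le_sum fun x hx => ?_
        rw [← exp_add]
        refine one_le_exp ?_
        have := mul_le_mul_of_nonneg_left (mem_filter.1 hx).2 hl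
        linarith
    _ ≤ ∑ x : β → Fin r, exp (l * a) * exp (-l * #{v ∈ F | pos v + x (blk v) = j}) :=
        sum_le_sum_of_subset_of_nonneg (filter_subset _ _) fun _ _ _ => by positivity
    _ ≤ exp (l * a) * (exp (-((1 - exp (-l)) * (#F / r))) * Fintype.card (β → Fin r)) := by
        rw [← mul_sum]
        gcongr
    _ = _ := by rw [← mul_assoc, ← exp_add, ← sub_eq_add_neg]

/-- The elements of `W` can be arranged in consecutive blocks of size `r`, the last of which may be
incomplete. -/
theorem exists_blocks {V : Type*} (W : Finset V) (r : ℕ) [NeZero r] :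
    ∃ (blk : V → Fin (#W + 1)) (pos : V → Fin r),
      (∀ u ∈ W, ∀ v ∈ W, blk u = blk v → pos u = pos v → u = v) ∧
      (∀ q < #W / r, ∀ p : Fin r, ∃ v ∈ W, (blk v : ℕ) = q ∧ pos v = p) ∧
      ∀ v ∈ W, (blk v : ℕ) < (#W + r - 1) / r := by
  classical
  have hr : 0 < r := Nat.pos_of_ne_zero (NeZero.ne r)
  obtain ⟨idx, hidx, hlt, hsurj⟩ : ∃ idx : V → ℕ,
      (∀ u ∈ W, ∀ v ∈ W, idx u = idx v → u = v) ∧ (∀ v, idx v < #W + 1 ∧ (v ∈ W → idx v < #W)) ∧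
      ∀ i < #W, ∃ v ∈ W, idx v = i := by
    refine ⟨fun v => if h : v ∈ W then (W.equivFin ⟨v, h⟩ : ℕ) else 0, ?_, ?_, ?_⟩
    · intro u hu v hv h
      simpa [hu, hv, Fin.val_inj] using h
    · intro v
      by_cases hv : v ∈ W
      · have := (W.equivFin ⟨v, hv⟩).isLt
        simp only [hv, dite_true]
        omega
      · simp [hv]
    · intro i hi
      refine ⟨W.equivFin.symm ⟨i, hi⟩, (W.equivFin.symm ⟨i, hi⟩).2, ?_⟩
      simp
  refine ⟨fun v => ⟨idx v / r, (Nat.div_le_self _ _).trans_lt (hlt v).1⟩,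
    fun v => ⟨idx v % r, Nat.mod_lt _ hr⟩, ?_, ?_, ?_⟩
  · intro u hu v hv h1 h2
    rw [Fin.mk.injEq] at h1 h2
    refine hidx u hu v hv ?_
    rw [← Nat.div_add_mod (idx u) r, ← Nat.div_add_mod (idx v) r, h1, h2]
  · intro q hq p
    have hlt : r * q + p < #W := by
      have h1 : r * (q + 1) ≤ r * (#W / r) := Nat.mul_le_mul_left _ hq
      have h2 := Nat.mul_div_le #W r
      have h3 := p.isLt
      rw [Nat.mul_add, mul_one] at h1
      omega
    obtain ⟨v, hv, hvi⟩ := hsurj _ hlt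
    refine ⟨v, hv, ?_, ?_⟩
    · simp [hvi, Nat.mul_add_div hr, Nat.div_eq_of_lt p.isLt]
    · ext
      simp [hvi, Nat.mod_eq_of_lt p.isLt]
  · intro v hv
    have h := (hlt v).2 hv
    have h1 := Nat.div_add_mod (idx v) r
    have h2 : r * (idx v / r) + r ≤ #W + r - 1 := by omega
    show idx v / r < _
    rw [Nat.lt_iff_add_one_le, Nat.le_div_iff_mul_le hr, add_mul, one_mul, mul_comm]
    exact h2

/-- A uniform hypergraph of bounded degree has an equitable colouring in which every edge contains
more than `a` vertices of each colour. -/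
theorem exists_equitable_coloring {V ι : Type*} [DecidableEq V] [Fintype ι]
    (W : Finset V) (E : ι → Finset V) {s Δ r : ℕ} [NeZero r] (hs : 0 < s) (hΔ : 0 < Δ)
    (hEW : ∀ i, E i ⊆ W) (hEs : ∀ i, #(E i) = s) (hdeg : ∀ v, #{i | v ∈ E i} ≤ Δ)
    {a l : ℝ} (hl : 0 ≤ l)
    (hsmall : 4 * exp (l * a - (1 - exp (-l)) * (s / r)) * ((s * r * Δ * r : ℕ) : ℝ) ≤ 1) :
    ∃ c : V → Fin r,
      (∀ j, #W / r ≤ #{v ∈ W | c v = j} ∧ #{v ∈ W | c v = j} ≤ (#W + r - 1) / r) ∧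
      ∀ i j, a < #{v ∈ E i | c v = j} := by
  classical
  have hr : 0 < r := Nat.pos_of_ne_zero (NeZero.ne r)
  obtain ⟨blk, pos, hinj, hsurj, hblk⟩ := exists_blocks W r
  have hsize : ∀ (x : Fin (#W + 1) → Fin r) (j : Fin r),
      #W / r ≤ #{v ∈ W | pos v + x (blk v) = j} ∧
        #{v ∈ W | pos v + x (blk v) = j} ≤ (#W + r - 1) / r := by
    intro x j
    constructor
    · rw [← card_range (#W / r)]
      refine card_le_card_of_surjOn (fun v => (blk v : ℕ)) fun q hq => ?_
      have hq : q < #W / r := by simpa using hq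
      have hqW : q < #W + 1 := (hq.trans_le (Nat.div_le_self _ _)).trans (Nat.lt_succ_self _)
      obtain ⟨v, hv, h1, h2⟩ := hsurj q hq (j - x ⟨q, hqW⟩)
      refine ⟨v, ?_, h1⟩
      have : blk v = ⟨q, hqW⟩ := Fin.ext h1
      simp [hv, h2, this]
    · rw [← card_range ((#W + r - 1) / r)]
      refine card_le_card_of_injOn (fun v => (blk v : ℕ)) ?_ ?_
      · intro v hv
        simp only [coe_filter, Set.mem_ofPred_eq] at hv
        simpa using hblk v hv.1
      · intro u hu v hv h
        simp only [coe_filter, Set.mem_ofPred_eq] at hu hv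
        have h : blk u = blk v := Fin.ext h
        refine hinj u hu.1 v hv.1 h ?_
        have := hu.2.trans hv.2.symm
        rw [h] at this
        exact add_right_cancel this
  let A : ι × Fin r → Finset (Fin (#W + 1) → Fin r) := fun e =>
    {x | (#{v ∈ E e.1 | pos v + x (blk v) = e.2} : ℝ) ≤ a}
  let N : ι → Finset ι := fun i => {i' | ∃ u ∈ E i, ∃ v ∈ E i', blk u = blk v}
  have hN : ∀ i, #(N i) ≤ s * r * Δ := by
    intro i
    have hsub : N i ⊆ (E i ×ˢ (univ : Finset (Fin r))).biUnion fun z =>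
        ({v ∈ W | blk v = blk z.1 ∧ pos v = z.2} : Finset V).biUnion fun v => {i' | v ∈ E i'} := by
      intro i' hi'
      obtain ⟨u, hu, v, hv, huv⟩ := (mem_filter.1 hi').2
      refine mem_biUnion.2 ⟨(u, pos v), by simp [hu], mem_biUnion.2 ⟨v, ?_, by simp [hv]⟩⟩
      simp [hEW i' hv, huv]
    refine (card_le_card hsub).trans ((card_biUnion_le_card_mul _ _ Δ fun z _ => ?_).trans ?_)
    · refine (card_biUnion_le_card_mul _ _ Δ fun v _ => hdeg v).trans ?_
      refine (Nat.mul_le_mul_right Δ (card_le_one.2 fun u hu v hv => ?_)).trans (one_mul Δ).le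
      simp only [mem_filter] at hu hv
      exact hinj u hu.1 v hv.1 (hu.2.1.trans hv.2.1.symm) (hu.2.2.trans hv.2.2.symm)
    · simp [card_product, hEs i]
  have hdet : ∀ (e : ι × Fin r) (x y : Fin (#W + 1) → Fin r),
      (∀ v ∈ E e.1, x (blk v) = y (blk v)) → x ∈ A e → y ∈ A e := by
    intro e x y hxy hx
    have : ({v ∈ E e.1 | pos v + x (blk v) = e.2} : Finset V) =
        {v ∈ E e.1 | pos v + y (blk v) = e.2} :=
      filter_congr fun v hv => by rw [hxy v hv]
    simpa [A, this] using hx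
  obtain ⟨x, hx⟩ := exists_forall_notMem_of_local_lemma A (fun e => N e.1 ×ˢ univ)
    (exp_pos _).le (d := s * r * Δ * r) (by positivity)
    (fun e => by
      rw [card_product, card_univ, Fintype.card_fin]
      exact Nat.mul_le_mul_right r (hN e.1))
    hsmall
    (fun e => by
      have := card_few_of_color_le (E e.1) blk pos
        (fun u hu v hv => hinj u (hEW _ hu) v (hEW _ hv)) e.2 a hl
      rwa [hEs] at this)
    (fun e S hS => by
      refine card_inter_mul_card_pi ((E e.1).image blk) _ _
        (fun x y h => hdet e x y fun v hv => h _ (mem_image_of_mem _ hv)) fun x y h hx => ?_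
      rw [mem_avoiding] at hx ⊢
      intro e' he' hy
      refine hx e' he' (hdet e' y x (fun v hv => (h _ fun hmem => ?_).symm) hy)
      obtain ⟨u, hu, huv⟩ := mem_image.1 hmem
      refine disjoint_left.1 hS he' ?_
      simp only [mem_product, mem_univ, and_true]
      exact mem_filter.2 ⟨mem_univ _, u, hu, v, hv, huv⟩)
  refine ⟨fun v => pos v + x (blk v), hsize x, fun i j => ?_⟩
  have := hx (i, j)
  simpa [A] using this

/-- Splitting the vertices into `t` parts that each contain at least `s` neighbours of every vertex,
and then colouring each part with `r` colours, gives an equitable partition into `t * r` total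
dominating sets. -/
theorem exists_equitable_total_dominating_partition {V : Type*} [Fintype V] [DecidableEq V]
    (G : SimpleGraph V) [DecidableRel G.Adj] {k t s r : ℕ} (hG : G.IsRegularOfDegree k)
    (hk : 0 < k) (ht : 0 < t) (hs : 0 < s) (hr : 0 < r) {l m : ℝ} (hl : 0 ≤ l) (hm : 0 ≤ m)
    (hsplit : 4 * exp (l * (s - 1) - (1 - exp (-l)) * (k / t)) * ((k * t * k * t : ℕ) : ℝ) ≤ 1)
    (hcolor : 4 * exp (-((1 - exp (-m)) * (s / r))) * ((s * r * k * r : ℕ) : ℝ) ≤ 1) :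
    ∃ P : Fin (t * r) → Finset V,
      (∀ i j, i ≠ j → Disjoint (P i) (P j)) ∧
      (univ.biUnion P = (univ : Finset V)) ∧
      (∀ i, #(P i) = Fintype.card V / (t * r) ∨
        #(P i) = (Fintype.card V + t * r - 1) / (t * r)) ∧
      ∀ i, ∀ v : V, ∃ u ∈ P i, G.Adj v u := by
  have : NeZero t := ⟨ht.ne'⟩
  have : NeZero r := ⟨hr.ne'⟩
  have hcardN : ∀ v, #(G.neighborFinset v) = k := fun v => hG v
  obtain ⟨c, hcsize, hc⟩ := exists_equitable_coloring (univ : Finset V)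
    (fun v => G.neighborFinset v) hk hk (fun _ => subset_univ _) hcardN
    (fun v => by
      rw [← hcardN v]
      refine card_le_card fun u hu => ?_
      simpa [G.adj_comm] using hu) hl hsplit
  have hsub : ∀ (i : Fin t) (v : V), ∃ F ⊆ {u ∈ G.neighborFinset v | c u = i}, #F = s := by
    intro i v
    refine exists_subset_card_eq ?_
    have h : (s : ℝ) < #{u ∈ G.neighborFinset v | c u = i} + 1 := by linarith [hc v i]
    exact Nat.lt_succ_iff.1 (by exact_mod_cast h)
  choose F hF hFs using hsub
  have hcol := fun i : Fin t => exists_equitable_coloring ({u | c u = i} : Finset V) (F i) (r := r)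
    (a := 0) hs hk (fun v => (hF i v).trans (filter_subset_filter _ (subset_univ _))) (hFs i)
    (fun u => by
      rw [← hcardN u]
      refine card_le_card fun v hv => ?_
      have := hF i v (mem_filter.1 hv).2
      simp only [mem_filter, SimpleGraph.mem_neighborFinset] at this ⊢
      exact this.1.symm) hm (by simpa using hcolor)
  choose d hdsize hd using hcol
  let P : Fin (t * r) → Finset V := fun e =>
    {v | c v = (finProdFinEquiv.symm e).1 ∧
      d (finProdFinEquiv.symm e).1 v = (finProdFinEquiv.symm e).2}
  refine ⟨P, fun e f hef => ?_, ?_, fun e => ?_, fun e v => ?_⟩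
  · rw [disjoint_left]
    intro v hv hv'
    simp only [P, mem_filter, mem_univ, true_and] at hv hv'
    refine hef (finProdFinEquiv.symm.injective (Prod.ext (hv.1.symm.trans hv'.1) ?_))
    rw [← hv.2, ← hv'.2, ← hv.1, ← hv'.1]
  · ext v
    simp only [mem_biUnion, mem_univ, true_and, iff_true]
    exact ⟨finProdFinEquiv (c v, d (c v) v), by
      simp only [P, mem_filter, mem_univ, Equiv.symm_apply_apply, and_self]⟩
  · obtain ⟨h1, h2⟩ := hcsize (finProdFinEquiv.symm e).1
    obtain ⟨h3, h4⟩ := hdsize (finProdFinEquiv.symm e).1 (finProdFinEquiv.symm e).2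
    rw [filter_filter] at h3 h4
    rw [card_univ] at h1 h2
    have hlow : Fintype.card V / (t * r) ≤ #(P e) := by
      rw [← Nat.div_div_eq_div_mul]
      exact (Nat.div_le_div_right h1).trans h3
    have hupp : #(P e) ≤ (Fintype.card V + t * r - 1) / (t * r) := by
      refine h4.trans ((Nat.div_le_div_right (c := r)
        (b := (Fintype.card V + t - 1) / t + (r - 1)) (by omega)).trans (le_of_eq ?_))
      rw [← Nat.add_mul_div_left _ _ ht, Nat.div_div_eq_div_mul]
      congr 1
      have : t * r = t * (r - 1) + t := by
        obtain ⟨r, rfl⟩ := Nat.exists_eq_succ_of_ne_zero hr.ne'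
        simp [Nat.mul_succ]
      omega
    have htr : 0 < t * r := Nat.mul_pos ht hr
    have hgap : (Fintype.card V + t * r - 1) / (t * r) ≤ Fintype.card V / (t * r) + 1 := by
      rw [← Nat.add_div_right _ htr]
      exact Nat.div_le_div_right (Nat.sub_le _ _)
    omega
  · have h := hd (finProdFinEquiv.symm e).1 v (finProdFinEquiv.symm e).2
    obtain ⟨u, hu⟩ := card_pos.1 (by exact_mod_cast h)
    rw [mem_filter] at hu
    have hu' := hF _ _ hu.1
    rw [mem_filter, SimpleGraph.mem_neighborFinset] at hu'
    exact ⟨u, mem_filter.2 ⟨mem_univ _, hu'.2, hu.2⟩, hu'.1⟩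

theorem exp_neg_le_one_sub_add_sq {x : ℝ} (hx : 0 ≤ x) : exp (-x) ≤ 1 - x + x ^ 2 / 2 := by
  have h := quadratic_le_exp_of_nonneg hx
  rw [exp_neg, inv_le_iff_one_le_mul₀ (exp_pos x)]
  have h1 : 0 ≤ 1 - x + x ^ 2 / 2 := by nlinarith [sq_nonneg (x - 1)]
  nlinarith [mul_le_mul_of_nonneg_left h h1, sq_nonneg (x ^ 2)]

/-- The splitting condition holds once `μ` is of order `L ^ 2` for large `L`. -/
theorem splitting_condition {δ L μ x k t : ℝ} (hδ : 0 < δ) (hL : 7 ≤ L) (hLδ : 12 ≤ L * δ ^ 2)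
    (hμ : L ^ 2 ≤ μ) (hx : x ≤ (1 - δ) * μ) (hk : exp L = k) (ht : 0 ≤ t) (htk : t ≤ k) :
    4 * exp (δ * x - (1 - exp (-δ)) * μ) * (k * t * k * t) ≤ 1 := by
  have hk0 : 0 < k := hk ▸ exp_pos L
  have hμ0 : 0 ≤ μ := (sq_nonneg L).trans hμ
  have h1 : δ * x - (1 - exp (-δ)) * μ ≤ -(2 + 4 * L) := by
    have h2 := exp_neg_le_one_sub_add_sq hδ.le
    have h3 : (δ - δ ^ 2 / 2) * μ ≤ (1 - exp (-δ)) * μ :=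
      mul_le_mul_of_nonneg_right (by linarith) hμ0
    have h4 := mul_le_mul_of_nonneg_left hx hδ.le
    have h5 : δ ^ 2 / 2 * L ^ 2 ≤ δ ^ 2 / 2 * μ := by gcongr
    have h6 : 12 * L ≤ L * δ ^ 2 * L := mul_le_mul_of_nonneg_right hLδ (by linarith)
    linarith
  have h4 : (4 : ℝ) ≤ exp 2 := by
    have := add_one_le_exp (1 : ℝ)
    have h2 : exp 2 = exp 1 * exp 1 := by rw [← exp_add]; norm_num
    nlinarith
  have h5 : k * t * k * t ≤ exp (4 * L) := by
    have : exp (4 * L) = k * k * k * k := by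
      rw [← hk, ← exp_add, ← exp_add, ← exp_add]
      ring_nf
    rw [this]
    gcongr
  calc _ ≤ exp 2 * exp (-(2 + 4 * L)) * exp (4 * L) := by gcongr
    _ = 1 := by rw [← exp_add, ← exp_add]; simp

/-- The colouring condition holds once `s` is of order `L ^ 2` and `s / r` slightly exceeds `L`. -/
theorem coloring_condition {δ L s r k : ℝ} (hδ : 0 < δ) (hδ7 : δ ≤ 1 / 7) (hL : 0 < L)
    (hLδ : 108 * L ^ 6 ≤ exp (δ * L)) (hs : s ≤ 3 * L ^ 2) (hr : 0 < r) (hrs : r ≤ s)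
    (hsr : (1 + 4 * δ) * L ≤ s / r) (hk : exp L = k) :
    4 * exp (-((1 - δ) * (s / r))) * (s * r * k * r) ≤ 1 := by
  have hk0 : 0 < k := hk ▸ exp_pos L
  have h2 : -((1 - δ) * (s / r)) ≤ -L + -(δ * L) := by
    have h3 := mul_le_mul_of_nonneg_left hsr (by linarith : 0 ≤ 1 - δ)
    have h4 : (1 + δ) * L ≤ (1 - δ) * ((1 + 4 * δ) * L) := by
      rw [← mul_assoc]
      gcongr
      nlinarith
    linarith
  have hr3 : r ≤ 3 * L ^ 2 := hrs.trans hs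
  have hs0 : 0 < s := hr.trans_le hrs
  calc _ ≤ 4 * exp (-L + -(δ * L)) * ((3 * L ^ 2) * (3 * L ^ 2) * k * (3 * L ^ 2)) := by
        gcongr
    _ = (exp (-L) * k) * (exp (-(δ * L)) * (108 * L ^ 6)) := by rw [exp_add]; ring
    _ ≤ 1 * (exp (-(δ * L)) * exp (δ * L)) := by
        gcongr
        rw [← hk, ← exp_add]
        simp
    _ = 1 := by rw [← exp_add]; simp

/-- For large `k` the numerical conditions of `exists_equitable_total_dominating_partition` can be
met with `t * r` close to `k / log k`. -/
theorem exists_splitting_parameters {δ : ℝ} (hδ : 0 < δ) (hδ7 : δ ≤ 1 / 7) :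
    ∃ k0 : ℕ, ∀ k : ℕ, k0 ≤ k → ∃ (t s r : ℕ) (l m : ℝ),
      0 < k ∧ 0 < t ∧ 0 < s ∧ 0 < r ∧ 0 ≤ l ∧ 0 ≤ m ∧
      4 * exp (l * (s - 1) - (1 - exp (-l)) * (k / t)) * ((k * t * k * t : ℕ) : ℝ) ≤ 1 ∧
      4 * exp (-((1 - exp (-m)) * (s / r))) * ((s * r * k * r : ℕ) : ℝ) ≤ 1 ∧
      (1 - 7 * δ) * k / log k ≤ ((t * r : ℕ) : ℝ) := by
  have hev : ∀ᶠ L : ℝ in Filter.atTop, 12 / δ ^ 2 ≤ L ∧ 108 * L ^ 6 ≤ exp (δ * L) := by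
    refine (Filter.eventually_ge_atTop _).and ?_
    have h := (isLittleO_pow_exp_pos_mul_atTop (k := 6) hδ).bound (c := 1 / 108) (by norm_num)
    filter_upwards [h, Filter.eventually_ge_atTop 0] with L hL hL0
    rw [norm_of_nonneg (by positivity), norm_of_nonneg (by positivity)] at hL
    linarith
  obtain ⟨k0, hk0⟩ := Filter.eventually_atTop.1
    ((tendsto_log_atTop.comp tendsto_natCast_atTop_atTop).eventually hev)
  refine ⟨max k0 1, fun k hk => ?_⟩
  obtain ⟨hL1, hL2⟩ := hk0 k (le_trans (le_max_left _ _) hk)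
  have hkpos : 0 < k := le_trans (le_max_right _ _) hk
  have hkR : (0 : ℝ) < k := by exact_mod_cast hkpos
  simp only [Function.comp_apply] at hL1 hL2
  set L := log k with hLdef
  have hexpL : exp L = k := exp_log hkR
  rw [div_le_iff₀ (by positivity)] at hL1
  have hLδ : 1 ≤ L * δ := by nlinarith
  have hL7 : 7 ≤ L := by nlinarith
  have hL0 : 0 < L := by linarith
  have hkL : L ^ 2 ≤ δ * k := by
    have h1 : exp (δ * L) ≤ k := by
      rw [← hexpL]
      exact exp_le_exp.2 (by nlinarith)
    have h2 : L ^ 3 ≤ 108 * L ^ 6 := by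
      have : (1 : ℝ) ≤ L ^ 3 := one_le_pow₀ (by linarith)
      nlinarith [sq_nonneg (L ^ 3)]
    have h3 : L ^ 3 ≤ k := by linarith
    nlinarith [sq_nonneg L, mul_le_mul_of_nonneg_left hLδ (sq_nonneg L)]
  set t := ⌊k / L ^ 2⌋₊ with ht
  have htle : (t : ℝ) ≤ k / L ^ 2 := Nat.floor_le (by positivity)
  have htge : (1 - δ) * (k / L ^ 2) ≤ t := by
    have h1 := Nat.lt_floor_add_one (k / L ^ 2)
    have h2 : 1 ≤ δ * (k / L ^ 2) := by
      rw [← mul_div_assoc, one_le_div (by positivity)]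
      exact hkL
    rw [← ht] at h1
    linarith
  have htR : (0 : ℝ) < t := lt_of_lt_of_le (mul_pos (by linarith) (by positivity)) htge
  have htk : (t : ℝ) ≤ k := htle.trans (div_le_self hkR.le (one_le_pow₀ (by linarith)))
  have hμ1 : L ^ 2 ≤ k / t := by
    rw [le_div_iff₀ htR]
    rwa [le_div_iff₀ (by positivity), mul_comm] at htle
  have hμ2 : (k : ℝ) / t ≤ 2 * L ^ 2 := by
    rw [div_le_iff₀ htR]
    have h1 : (1 - δ) * k ≤ t * L ^ 2 := by
      rwa [← mul_div_assoc, div_le_iff₀ (by positivity)] at htge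
    nlinarith
  set μ : ℝ := k / t with hμ
  set s := ⌊(1 - δ) * μ⌋₊ + 1 with hs
  have hμ0 : 0 < μ := by positivity
  have hsle : (s : ℝ) - 1 ≤ (1 - δ) * μ := by
    rw [hs]
    push_cast
    have := Nat.floor_le (mul_nonneg (by linarith : 0 ≤ 1 - δ) hμ0.le)
    linarith
  have hsge : (1 - δ) * μ ≤ s := by
    rw [hs]
    push_cast
    exact (Nat.lt_floor_add_one _).le
  have hs0 : 0 < s := Nat.succ_pos _
  have hsR : (0 : ℝ) < s := by exact_mod_cast hs0
  have hs3 : (s : ℝ) ≤ 3 * L ^ 2 := by nlinarith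
  set r := ⌊s / ((1 + 4 * δ) * L)⌋₊ with hr
  have hden : 0 < (1 + 4 * δ) * L := by positivity
  have hrle : (r : ℝ) ≤ s / ((1 + 4 * δ) * L) := Nat.floor_le (by positivity)
  have hrs : (r : ℝ) ≤ s := hrle.trans (div_le_self hsR.le (by nlinarith))
  have htr : (1 - 7 * δ) * k / L + δ * (k / L) ≤ t * r := by
    have h1 : (s : ℝ) / ((1 + 4 * δ) * L) - 1 ≤ r := (Nat.sub_one_lt_floor _).le
    have h2 : (1 - δ) * μ / ((1 + 4 * δ) * L) - 1 ≤ r := by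
      have : (1 - δ) * μ / ((1 + 4 * δ) * L) ≤ s / ((1 + 4 * δ) * L) := by gcongr
      linarith
    have h3 := mul_le_mul_of_nonneg_left h2 htR.le
    have h4 : t * ((1 - δ) * μ / ((1 + 4 * δ) * L) - 1) =
        (1 - δ) / (1 + 4 * δ) * (k / L) - t := by
      rw [hμ]
      field_simp
    have h5 : (t : ℝ) ≤ δ * (k / L) := by
      refine htle.trans ?_
      have : (k : ℝ) / L ^ 2 = (1 / L) * (k / L) := by field_simp
      rw [this]
      gcongr
      rw [div_le_iff₀ hL0]
      linarith
    have h6 : 1 - 5 * δ ≤ (1 - δ) / (1 + 4 * δ) := by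
      rw [le_div_iff₀ (by positivity)]
      nlinarith
    have h7 := mul_le_mul_of_nonneg_right h6 (by positivity : 0 ≤ k / L)
    rw [h4] at h3
    have h8 : (1 - 7 * δ) * k / L = (1 - 7 * δ) * (k / L) := by ring
    rw [h8]
    linarith
  have hrR : (0 : ℝ) < r := by
    have h1 : 0 < δ * (k / L) := by positivity
    have h2 : 0 ≤ (1 - 7 * δ) * k / L :=
      div_nonneg (mul_nonneg (by linarith) hkR.le) hL0.le
    exact pos_of_mul_pos_right (lt_of_lt_of_le (by linarith) htr) htR.le
  refine ⟨t, s, r, δ, -log δ, hkpos, by exact_mod_cast htR, hs0, by exact_mod_cast hrR, hδ.le,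
    ?_, ?_, ?_, ?_⟩
  · rw [Left.nonneg_neg_iff]
    exact log_nonpos hδ.le (by linarith)
  · push_cast
    exact splitting_condition hδ hL7 hL1 hμ1 hsle hexpL htR.le htk
  · rw [neg_neg, exp_log hδ]
    push_cast
    refine coloring_condition hδ hδ7 hL0 hL2 hs3 hrR hrs ?_ hexpL
    rw [le_div_iff₀ hrR, mul_comm]
    rwa [le_div_iff₀ hden] at hrle
  · have : 0 ≤ δ * (k / L) := by positivity
    push_cast
    linarith

/-- Every k-regular graph has an equitable partition of its vertex set into
(1-o_k(1))k/ln k parts, each of which is a total dominating set. -/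
theorem stmt18 (ε : ℝ) (hε : 0 < ε) :
    ∃ k0 : ℕ, ∀ k : ℕ, k ≥ k0 →
      ∀ (V : Type) (_ : Fintype V) (_ : DecidableEq V) (G : SimpleGraph V)
        (_ : DecidableRel G.Adj), G.IsRegularOfDegree k →
      ∃ r : ℕ, (1 - ε) * k / Real.log k ≤ (r : ℝ) ∧
        ∃ P : Fin r → Finset V,
          (∀ i j, i ≠ j → Disjoint (P i) (P j)) ∧
          (Finset.univ.biUnion P = (Finset.univ : Finset V)) ∧
          (∀ i, (P i).card = Fintype.card V / r ∨
                (P i).card = (Fintype.card V + r - 1) / r) ∧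
          (∀ i, ∀ v : V, ∃ u ∈ P i, G.Adj v u) := by
  obtain ⟨k0, hk0⟩ := exists_splitting_parameters (δ := min ε 1 / 7) (by positivity)
    (by linarith [min_le_right ε 1])
  refine ⟨k0, fun k hk V _ _ G _ hG => ?_⟩
  obtain ⟨t, s, r, l, m, hkpos, ht, hs, hr, hl, hm, hsplit, hcolor, htr⟩ := hk0 k hk
  refine ⟨t * r, le_trans ?_ htr,
    exists_equitable_total_dominating_partition G hG hkpos ht hs hr hl hm hsplit hcolor⟩
  have : 0 ≤ Real.log k := Real.log_natCast_nonneg k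
  gcongr
  linarith [min_le_left ε 1]
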